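/- arXiv:2002.04750 — 2 statements merged into one kernel-verified Lean document; each statement's English description precedes it below -/
import Mathlib

section
/- Let p be a prime and G a finite group. Let X be a Zp[G]-module that is a free Zp-module of finite rank, and let S = Hom(X, Qp/Zp) be its Pontryagin dual with the induced G-action. If H^1(H, S) = 0 and H^2(H, S) = 0 for every subgroup H of G, then X is projective as a Zp[G]-module. -/
/-- The Pontryagin-dual coefficient module `ℚ_p/ℤ_p`. -/
abbrev QpZp (p : ℕ) [Fact p.Prime] :=
  ℚ_[p] ⧸ LinearMap.range (Algebra.linearMap ℤ_[p] ℚ_[p])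

namespace PfAux

open Representation

section general

variable {k G : Type} [CommRing k] [Group G]
variable {W0 W W1 : Type} [AddCommGroup W0] [Module k W0] [AddCommGroup W] [Module k W]
  [AddCommGroup W1] [Module k W1]

/-- Inhomogeneous 2-cocycles. -/
def Coc2 (τ : Representation k G W) (c : G → G → W) : Prop :=
  ∀ g h j, c (g * h) j + c g h = τ g (c h j) + c g (h * j)

/-- Inhomogeneous 1-cocycles. -/
def Coc1 (τ : Representation k G W) (c : G → W) : Prop :=
  ∀ g h, c (g * h) = τ g (c h) + c g

/-- Vanishing of `H^2`. -/
def Van2 (τ : Representation k G W) : Prop :=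
  ∀ c : G → G → W, Coc2 τ c → ∃ b : G → W, ∀ g h, τ g (b h) - b (g * h) + b g = c g h

/-- Vanishing of `H^1`. -/
def Van1 (τ : Representation k G W) : Prop :=
  ∀ c : G → W, Coc1 τ c → ∃ w : W, ∀ g, τ g w - w = c g

/-- Short exact sequences of representations. -/
structure SES (τ0 : Representation k G W0) (τ : Representation k G W)
    (τ1 : Representation k G W1) where
  i : W0 →ₗ[k] W
  q : W →ₗ[k] W1
  inj : Function.Injective i
  surj : Function.Surjective q
  zero : ∀ w, q (i w) = 0
  exact : ∀ w, q w = 0 → ∃ w0, i w0 = w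
  ei : ∀ g w, i (τ0 g w) = τ g (i w)
  eq : ∀ g w, q (τ g w) = τ1 g (q w)

variable {τ0 : Representation k G W0} {τ : Representation k G W} {τ1 : Representation k G W1}

theorem SES.mid2 (S : SES τ0 τ τ1) (h0 : Van2 τ0) (h1 : Van2 τ1) : Van2 τ := by
  intro c hc
  obtain ⟨b1, hb1⟩ := h1 (fun g h => S.q (c g h)) (by
    intro g h j
    rw [← map_add, hc, map_add, S.eq])
  choose b hb using fun g => S.surj (b1 g)
  choose c0 hc0 using fun g h => S.exact (c g h - (τ g (b h) - b (g * h) + b g)) (by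
    simp only [map_sub, map_add, S.eq, hb, hb1, sub_self])
  obtain ⟨b0, hb0⟩ := h0 c0 (by
    intro g h j
    apply S.inj
    have e := hc g h j
    simp only [map_add, S.ei, hc0, map_sub, mul_assoc, map_mul, Module.End.mul_apply]
    linear_combination (norm := abel) e)
  refine ⟨fun g => b g + S.i (b0 g), fun g h => ?_⟩
  have e := congrArg S.i (hb0 g h)
  simp only [map_add, S.ei, hc0, map_sub] at e ⊢
  linear_combination (norm := abel) e

theorem SES.left2 (S : SES τ0 τ τ1) (h1 : Van1 τ1) (h2 : Van2 τ) : Van2 τ0 := by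
  intro c hc
  obtain ⟨b, hb⟩ := h2 (fun g h => S.i (c g h)) (by
    intro g h j
    rw [← map_add, hc, map_add, S.ei])
  obtain ⟨m1, hm1⟩ := h1 (fun g => S.q (b g)) (by
    intro g h
    have e := congrArg S.q (hb g h)
    simp only [map_add, map_sub, S.eq, S.zero] at e
    linear_combination (norm := abel) -e)
  obtain ⟨m, hm⟩ := S.surj m1
  choose b0 hb0 using fun g => S.exact (b g - (τ g m - m)) (by
    simp only [map_sub, S.eq, hm, hm1, sub_self])
  refine ⟨b0, fun g h => S.inj ?_⟩
  have e := hb g h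
  simp only [map_add, S.ei, hb0, map_sub, map_mul, Module.End.mul_apply]
  linear_combination (norm := abel) e

theorem SES.right1 (S : SES τ0 τ τ1) (h0 : Van2 τ0) (h1 : Van1 τ) : Van1 τ1 := by
  intro c hc
  choose b hb using fun g => S.surj (c g)
  choose c0 hc0 using fun g h => S.exact (τ g (b h) - b (g * h) + b g) (by
    simp only [map_sub, map_add, S.eq, hb, hc g h]; abel)
  obtain ⟨b0, hb0⟩ := h0 c0 (by
    intro g h j
    apply S.inj
    simp only [map_add, S.ei, hc0, map_sub, mul_assoc, map_mul, Module.End.mul_apply]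
    abel)
  obtain ⟨t, ht⟩ := h1 (fun g => b g - S.i (b0 g)) (by
    intro g h
    have e := congrArg S.i (hb0 g h)
    simp only [map_add, S.ei, hc0, map_sub] at e ⊢
    linear_combination (norm := abel) e)
  refine ⟨S.q t, fun g => ?_⟩
  rw [← S.eq, ← map_sub, ht, map_sub, S.zero, sub_zero, hb]

theorem SES.right0 (S : SES τ0 τ τ1) (h0 : Van1 τ0) (w1 : W1) (hw : ∀ g, τ1 g w1 = w1) :
    ∃ w, S.q w = w1 ∧ ∀ g, τ g w = w := by
  obtain ⟨w, rfl⟩ := S.surj w1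
  choose c0 hc0 using fun g => S.exact (τ g w - w) (by
    simp only [map_sub, S.eq, hw, sub_self])
  obtain ⟨t, ht⟩ := h0 c0 (by
    intro g h
    apply S.inj
    simp only [map_add, S.ei, hc0, map_sub, map_mul, Module.End.mul_apply]
    abel)
  refine ⟨w - S.i t, by rw [map_sub, S.zero, sub_zero], fun g => ?_⟩
  have e := congrArg S.i (ht g)
  simp only [map_sub, S.ei, hc0] at e ⊢
  linear_combination (norm := abel) -e

theorem van2_subsingleton [Subsingleton W] : Van2 τ :=
  fun _ _ => ⟨fun _ => 0, fun _ _ => Subsingleton.elim _ _⟩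

variable {X : Type} [AddCommGroup X] [Module k X] (ρ : Representation k G X)

/-- `Hom(X, -)` is exact for `X` projective over the base ring. -/
noncomputable def SES.hom [Module.Projective k X] (S : SES τ0 τ τ1) :
    SES (linHom ρ τ0) (linHom ρ τ) (linHom ρ τ1) where
  i := LinearMap.compRight k S.i
  q := LinearMap.compRight k S.q
  inj a b h := by
    ext x
    exact S.inj (LinearMap.congr_fun h x)
  surj f := Module.projective_lifting_property S.q f S.surj
  zero w := by ext x; exact S.zero _
  exact w hw := by
    have hr : ∀ x, w x ∈ LinearMap.range S.i := fun x => S.exact _ (LinearMap.congr_fun hw x)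
    let e := LinearEquiv.ofInjective S.i S.inj
    refine ⟨e.symm.toLinearMap ∘ₗ w.codRestrict _ hr, ?_⟩
    ext x
    exact congrArg Subtype.val (e.apply_symm_apply ⟨w x, hr x⟩)
  ei g w := by ext x; exact S.ei _ _
  eq g w := by ext x; exact S.eq _ _

/-- The induced representation on functions. -/
def Ind (τ : Representation k G W) : Representation k G (G → W) where
  toFun g :=
    { toFun := fun u h => τ g (u (g⁻¹ * h))
      map_add' := fun u v => by ext h; simp
      map_smul' := fun r v => by ext h; simp }
  map_one' := by ext; simp
  map_mul' g h := by
    refine LinearMap.ext fun u => funext fun x => ?_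
    simp [mul_assoc]

theorem Ind_apply (g : G) (u : G → W) (h : G) : Ind τ g u h = τ g (u (g⁻¹ * h)) := rfl

theorem van1_Ind : Van1 (linHom ρ (Ind τ)) := by
  intro c hc
  refine ⟨LinearMap.pi fun h => - (LinearMap.proj h ∘ₗ c h), fun g => ?_⟩
  refine LinearMap.ext fun x => funext fun h => ?_
  have e := congrFun (LinearMap.congr_fun (hc g (g⁻¹ * h)) x) h
  simp only [mul_inv_cancel_left, LinearMap.add_apply, linHom_apply, LinearMap.comp_apply,
    Pi.add_apply, Ind_apply] at e
  simp only [linHom_apply, LinearMap.sub_apply, LinearMap.comp_apply, Pi.sub_apply, Ind_apply,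
    LinearMap.pi_apply, LinearMap.neg_apply, LinearMap.proj_apply, map_neg, e]
  abel

/-- The sum map from the induced representation. -/
def sumMap {k G W : Type} [CommRing k] [Fintype G] [AddCommGroup W] [Module k W] : (G → W) →ₗ[k] W := ∑ g, LinearMap.proj g

theorem sumMap_apply {k G W : Type} [CommRing k] [Fintype G] [AddCommGroup W] [Module k W] (u : G → W) : sumMap (k := k) u = ∑ g, u g := by
  simp [sumMap]

variable [Fintype G]

theorem sumMap_eq (g : G) (u : G → W) : sumMap (k := k) (Ind τ g u) = τ g (sumMap (k := k) u) := by
  rw [sumMap_apply, sumMap_apply, map_sum]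
  exact Fintype.sum_equiv (Equiv.mulLeft g⁻¹) _ _ fun h => rfl

variable (τ) in
theorem ker_le (g : G) : LinearMap.ker (sumMap (k := k) (G := G) (W := W)) ≤
    (LinearMap.ker (sumMap (k := k))).comap (Ind τ g) := by
  intro u hu
  rw [LinearMap.mem_ker] at hu
  rw [Submodule.mem_comap, LinearMap.mem_ker, sumMap_eq, hu, map_zero]

/-- The underlying module of the kernel of the sum map. -/
def KerT (k G W : Type) [CommRing k] [Fintype G] [AddCommGroup W] [Module k W] : Type :=
  LinearMap.ker (sumMap (k := k) (G := G) (W := W))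

instance (k G W : Type) [CommRing k] [Fintype G] [AddCommGroup W] [Module k W] :
    AddCommGroup (KerT k G W) :=
  inferInstanceAs (AddCommGroup (LinearMap.ker (sumMap (k := k) (G := G) (W := W))))

instance (k G W : Type) [CommRing k] [Fintype G] [AddCommGroup W] [Module k W] :
    Module k (KerT k G W) :=
  inferInstanceAs (Module k (LinearMap.ker (sumMap (k := k) (G := G) (W := W))))

instance (k G W : Type) [CommRing k] [Fintype G] [AddCommGroup W] [Module k W] [Finite W] :
    Finite (KerT k G W) :=
  inferInstanceAs (Finite (LinearMap.ker (sumMap (k := k) (G := G) (W := W))))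

/-- The kernel of the sum map. -/
def Ker (τ : Representation k G W) : Representation k G (KerT k G W) :=
  (Ind τ).subrepresentation _ (ker_le τ)

/-- The dimension-shifting sequence. -/
def indSES (τ : Representation k G W) : SES (Ker τ) (Ind τ) τ where
  i := Submodule.subtype (LinearMap.ker (sumMap (k := k) (G := G) (W := W)))
  q := sumMap
  inj := Subtype.val_injective
  surj w := by
    classical
    exact ⟨Pi.single 1 w, by rw [sumMap_apply]; simp⟩
  zero w := w.2
  exact w hw := ⟨⟨w, hw⟩, rfl⟩
  ei g w := rfl
  eq g w := sumMap_eq g w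

end general

section padic

variable {p : ℕ} [Fact p.Prime] {G : Type} [Group G]

/-- The map `ℤ_p/p → M` given by a `p`-torsion element. -/
noncomputable def toM {M : Type} [AddCommGroup M] [Module ℤ_[p] M] (m : M)
    (hm : (p : ℤ_[p]) • m = 0) : (ℤ_[p] ⧸ Ideal.span {(p : ℤ_[p])}) →ₗ[ℤ_[p]] M :=
  Submodule.liftQ _ (LinearMap.toSpanSingleton ℤ_[p] M m) (by
    rw [Ideal.span, Submodule.span_le, Set.singleton_subset_iff]
    simpa using hm)

theorem toM_mk {M : Type} [AddCommGroup M] [Module ℤ_[p] M] (m : M)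
    (hm : (p : ℤ_[p]) • m = 0) (x : ℤ_[p]) : toM m hm (Submodule.Quotient.mk x) = x • m := rfl

theorem toM_inj {M : Type} [AddCommGroup M] [Module ℤ_[p] M] (m : M)
    (hm : (p : ℤ_[p]) • m = 0) (h0 : m ≠ 0) : Function.Injective (toM m hm) := by
  rw [← LinearMap.ker_eq_bot, LinearMap.ker_eq_bot']
  intro y
  obtain ⟨x, rfl⟩ := Submodule.Quotient.mk_surjective _ y
  intro hx
  rw [toM_mk] at hx
  rw [Submodule.Quotient.mk_eq_zero, ← PadicInt.maximalIdeal_eq_span_p,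
    IsLocalRing.mem_maximalIdeal]
  intro hu
  exact h0 ((hu.smul_eq_zero).1 hx)

theorem p_ne : ((p : ℕ) : ℚ_[p]) ≠ 0 := Nat.cast_ne_zero.2 (Fact.out : p.Prime).ne_zero

theorem smul_mk (x : ℤ_[p]) (y : ℚ_[p]) :
    x • (Submodule.Quotient.mk y : QpZp p) = Submodule.Quotient.mk ((x : ℚ_[p]) * y) := by
  rw [← Submodule.Quotient.mk_smul, Algebra.smul_def]
  rfl

/-- The class of `1/p`. -/
noncomputable def pinv (p : ℕ) [Fact p.Prime] : QpZp p := Submodule.Quotient.mk ((p : ℚ_[p])⁻¹)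

theorem p_pinv : (p : ℤ_[p]) • pinv p = 0 := by
  rw [pinv, smul_mk, Submodule.Quotient.mk_eq_zero]
  exact ⟨1, by simp⟩

theorem pinv_ne : pinv p ≠ 0 := by
  rw [pinv, Ne, Submodule.Quotient.mk_eq_zero]
  rintro ⟨x, hx⟩
  have hx' : (x : ℚ_[p]) = (p : ℚ_[p])⁻¹ := hx
  have h1 := PadicInt.norm_le_one x
  rw [PadicInt.norm_def, hx', norm_inv, Padic.norm_p, inv_inv] at h1
  have : (1 : ℝ) < p := by exact_mod_cast (Fact.out : p.Prime).one_lt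
  linarith

/-- `0 → ℤ_p/p → ℚ_p/ℤ_p → ℚ_p/ℤ_p → 0`. -/
noncomputable def qSES : SES (Representation.trivial ℤ_[p] (G := G) (V := ℤ_[p] ⧸ Ideal.span {(p : ℤ_[p])}))
    (Representation.trivial ℤ_[p] (G := G) (V := QpZp p))
    (Representation.trivial ℤ_[p] (G := G) (V := QpZp p)) where
  i := toM (pinv p) p_pinv
  q := LinearMap.lsmul ℤ_[p] (QpZp p) (p : ℤ_[p])
  inj := toM_inj _ _ pinv_ne
  surj y := by
    obtain ⟨x, rfl⟩ := Submodule.Quotient.mk_surjective _ y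
    refine ⟨Submodule.Quotient.mk ((p : ℚ_[p])⁻¹ * x), ?_⟩
    rw [LinearMap.lsmul_apply, smul_mk, PadicInt.coe_natCast, mul_inv_cancel_left₀ p_ne]
  zero w := by
    obtain ⟨x, rfl⟩ := Submodule.Quotient.mk_surjective _ w
    rw [toM_mk, LinearMap.lsmul_apply, smul_comm, p_pinv, smul_zero]
  exact y hy := by
    obtain ⟨x, rfl⟩ := Submodule.Quotient.mk_surjective _ y
    rw [LinearMap.lsmul_apply, smul_mk, Submodule.Quotient.mk_eq_zero] at hy
    obtain ⟨z, hz⟩ := hy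
    have hz' : (z : ℚ_[p]) = (p : ℚ_[p]) * x := hz
    refine ⟨Submodule.Quotient.mk z, ?_⟩
    rw [toM_mk, pinv, smul_mk, hz', mul_comm, inv_mul_cancel_left₀ p_ne]
  ei g w := rfl
  eq g w := rfl

theorem exists_fixed [Finite G] (hG : IsPGroup p G) {V : Type} [AddCommGroup V] [Module ℤ_[p] V]
    [Finite V] [Nontrivial V] (hV : ∀ v : V, (p : ℤ_[p]) • v = 0) (σ : Representation ℤ_[p] G V) :
    ∃ v : V, v ≠ 0 ∧ ∀ g, σ g v = v := by
  let : MulAction G V :=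
    { smul := fun g v => σ g v
      one_smul := fun v => by change σ 1 v = v; simp
      mul_smul := fun g h v => by change σ (g * h) v = σ g (σ h v); simp }
  obtain ⟨v, hv⟩ := exists_ne (0 : V)
  have ho : addOrderOf v = p := by
    apply addOrderOf_eq_prime _ hv
    rw [← Nat.cast_smul_eq_nsmul ℤ_[p]]; exact hV v
  have hd : p ∣ Nat.card V := ho ▸ addOrderOf_dvd_natCard v
  obtain ⟨b, hb, hb0⟩ := hG.exists_fixed_point_of_prime_dvd_card_of_fixed_point V hd (a := 0)
    (fun g => map_zero (σ g))
  exact ⟨b, hb0.symm, fun g => hb g⟩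

theorem span_le_comap {V : Type} [AddCommGroup V] [Module ℤ_[p] V] (σ : Representation ℤ_[p] G V)
    (v : V) (hσ : ∀ g, σ g v = v) (g : G) :
    Submodule.span ℤ_[p] {v} ≤ (Submodule.span ℤ_[p] {v}).comap (σ g) := by
  rw [Submodule.span_le, Set.singleton_subset_iff]
  change σ g v ∈ Submodule.span ℤ_[p] {v}
  rw [hσ]; exact Submodule.mem_span_singleton_self v

/-- The sequence attached to a fixed vector. -/
noncomputable def fixSES {V : Type} [AddCommGroup V] [Module ℤ_[p] V] (σ : Representation ℤ_[p] G V)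
    (v : V) (hv : (p : ℤ_[p]) • v = 0) (h0 : v ≠ 0) (hσ : ∀ g, σ g v = v) :
    SES (Representation.trivial ℤ_[p] (G := G) (V := ℤ_[p] ⧸ Ideal.span {(p : ℤ_[p])})) σ
      (σ.quotient (Submodule.span ℤ_[p] {v}) (span_le_comap σ v hσ)) where
  i := toM v hv
  q := Submodule.mkQ _
  inj := toM_inj _ _ h0
  surj := Submodule.mkQ_surjective _
  zero w := by
    obtain ⟨x, rfl⟩ := Submodule.Quotient.mk_surjective _ w
    rw [toM_mk, Submodule.mkQ_apply, Submodule.Quotient.mk_eq_zero]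
    exact Submodule.smul_mem _ _ (Submodule.mem_span_singleton_self v)
  exact w hw := by
    rw [Submodule.mkQ_apply, Submodule.Quotient.mk_eq_zero, Submodule.mem_span_singleton] at hw
    obtain ⟨x, rfl⟩ := hw
    exact ⟨Submodule.Quotient.mk x, rfl⟩
  ei g w := by
    obtain ⟨x, rfl⟩ := Submodule.Quotient.mk_surjective _ w
    change toM v hv (Submodule.Quotient.mk x) = _
    rw [toM_mk, map_smul, hσ]
  eq g w := rfl

variable {X : Type} [AddCommGroup X] [Module ℤ_[p] X] [Module.Projective ℤ_[p] X]
  (ρ : Representation ℤ_[p] G X)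

theorem devissage [Finite G] (hG : IsPGroup p G)
    (hb : Van2 (linHom ρ (Representation.trivial ℤ_[p] (G := G)
      (V := ℤ_[p] ⧸ Ideal.span {(p : ℤ_[p])})))) (n : ℕ) :
    ∀ (V : Type) [AddCommGroup V] [Module ℤ_[p] V] [Finite V] (_ : ∀ v : V, (p : ℤ_[p]) • v = 0)
      (σ : Representation ℤ_[p] G V), Nat.card V ≤ n → Van2 (linHom ρ σ) := by
  induction n with
  | zero =>
    intro V _ _ _ hV σ hn
    exact absurd hn (by have := Nat.card_pos (α := V); omega)
  | succ n ih =>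
    intro V _ _ _ hV σ hn
    rcases subsingleton_or_nontrivial V with hs | hs
    · have : Subsingleton (X →ₗ[ℤ_[p]] V) := ⟨fun a b => by ext x; exact Subsingleton.elim _ _⟩
      exact van2_subsingleton
    · obtain ⟨v, h0, hσ⟩ := exists_fixed hG hV σ
      let S := fixSES σ v (hV v) h0 hσ
      have : Finite (V ⧸ Submodule.span ℤ_[p] {v}) := Finite.of_surjective _ S.surj
      refine (S.hom ρ).mid2 hb (ih _ ?_ _ ?_)
      · intro w
        obtain ⟨x, rfl⟩ := S.surj w
        rw [← map_smul, hV, map_zero]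
      · have hlt : Nat.card (V ⧸ Submodule.span ℤ_[p] {v}) < Nat.card V := by
          refine lt_of_le_of_ne (Nat.card_le_card_of_surjective _ S.surj) fun he => ?_
          have hbij := (Nat.bijective_iff_surjective_and_card S.q).2 ⟨S.surj, he.symm⟩
          apply h0
          apply hbij.1
          rw [map_zero]
          exact (Submodule.Quotient.mk_eq_zero _).2 (Submodule.mem_span_singleton_self v)
        omega

instance finQ : Finite (ℤ_[p] ⧸ Ideal.span {(p : ℤ_[p])}) := by
  rw [← PadicInt.maximalIdeal_eq_span_p]
  exact Finite.of_injective _ (PadicInt.residueField (p := p)).injective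

/-- The submodule `pX`. -/
noncomputable abbrev pX (p : ℕ) [Fact p.Prime] (X : Type) [AddCommGroup X] [Module ℤ_[p] X] :
    Submodule ℤ_[p] X :=
  Ideal.span {(p : ℤ_[p])} • (⊤ : Submodule ℤ_[p] X)

theorem mem_pX {x : X} : x ∈ pX p X ↔ ∃ y, (p : ℤ_[p]) • y = x := by
  rw [pX, Submodule.ideal_span_singleton_smul, Submodule.mem_smul_pointwise_iff_exists]
  simp

theorem pX_le (g : G) : pX p X ≤ (pX p X).comap (ρ g) := by
  intro x hx
  obtain ⟨y, rfl⟩ := mem_pX.1 hx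
  exact mem_pX.2 ⟨ρ g y, by simp⟩

theorem van1_ker [Fintype G]
    (d2 : ∀ (V : Type) [AddCommGroup V] [Module ℤ_[p] V] [Finite V]
      (_ : ∀ v : V, (p : ℤ_[p]) • v = 0) (σ : Representation ℤ_[p] G V), Van2 (linHom ρ σ))
    {V : Type} [AddCommGroup V] [Module ℤ_[p] V] [Finite V]
    (hV : ∀ v : V, (p : ℤ_[p]) • v = 0) (σ : Representation ℤ_[p] G V) :
    Van1 (linHom ρ (Ker σ)) := by
  refine ((indSES (Ker σ)).hom ρ).right1 (d2 _ ?_ _) (van1_Ind ρ)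
  intro v
  apply Subtype.ext; funext g; apply Subtype.ext; funext h
  exact hV _

theorem pgroup_case [Fintype G] [Module.Finite ℤ_[p] X] (hG : IsPGroup p G)
    (h1 : Van1 (linHom ρ (Representation.trivial ℤ_[p] (G := G) (V := QpZp p))))
    (h2 : Van2 (linHom ρ (Representation.trivial ℤ_[p] (G := G) (V := QpZp p)))) :
    ∃ f : X →ₗ[ℤ_[p]] X, ∀ x, ∑ g, ρ g (f (ρ g⁻¹ x)) = x := by
  have hb := ((qSES (p := p) (G := G)).hom ρ).left2 h1 h2
  have d2 := devissage ρ hG hb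
  have : Finite (X ⧸ pX p X) := Submodule.finite_quotient_smul _ Module.Finite.fg_top
  have hV : ∀ v : X ⧸ pX p X, (p : ℤ_[p]) • v = 0 := by
    intro v
    obtain ⟨x, rfl⟩ := Submodule.Quotient.mk_surjective _ v
    rw [← Submodule.Quotient.mk_smul, Submodule.Quotient.mk_eq_zero]
    exact mem_pX.2 ⟨x, rfl⟩
  let σ := ρ.quotient (pX p X) (pX_le ρ)
  have v1 := van1_ker ρ (fun V _ _ _ hV σ => d2 (Nat.card V) V hV σ le_rfl) hV σ
  obtain ⟨s, hs, hsi⟩ := ((indSES σ).hom ρ).right0 v1 (pX p X).mkQ (by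
    intro g
    ext x
    change Submodule.Quotient.mk (ρ g (ρ g⁻¹ x)) = Submodule.Quotient.mk x
    simp)
  obtain ⟨f, hf⟩ := Module.projective_lifting_property (pX p X).mkQ (LinearMap.proj 1 ∘ₗ s)
    (Submodule.mkQ_surjective _)
  let u : X →ₗ[ℤ_[p]] X := ∑ g, ρ g ∘ₗ f ∘ₗ ρ g⁻¹
  have hu : ∀ x, u x = ∑ g, ρ g (f (ρ g⁻¹ x)) := fun x => by simp [u]
  have huq : ∀ x, (pX p X).mkQ (u x) = (pX p X).mkQ x := by
    intro x
    have e := LinearMap.congr_fun hs x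
    change sumMap (k := ℤ_[p]) (s x) = _ at e
    rw [sumMap_apply] at e
    rw [← e, hu, map_sum]
    refine Finset.sum_congr rfl fun g _ => ?_
    have e2 := congrFun (LinearMap.congr_fun (hsi g) x) g
    rw [← e2, linHom_apply, LinearMap.comp_apply, LinearMap.comp_apply, Ind_apply, inv_mul_cancel]
    change σ g ((pX p X).mkQ (f (ρ g⁻¹ x))) = _
    exact congrArg (σ g) (LinearMap.congr_fun hf (ρ g⁻¹ x))
  have hsurj : Function.Surjective u := by
    rw [← LinearMap.range_eq_top, ← top_le_iff]
    refine Submodule.le_of_le_smul_of_le_jacobson_bot (I := Ideal.span {(p : ℤ_[p])})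
      Module.Finite.fg_top ?_ ?_
    · rw [← PadicInt.maximalIdeal_eq_span_p, IsLocalRing.jacobson_eq_maximalIdeal _ bot_ne_top]
    · intro x _
      have := (Submodule.Quotient.eq _).1 (huq x).symm
      rw [← sub_add_cancel x (u x), add_comm]
      exact Submodule.add_mem_sup ⟨x, rfl⟩ this
  have hinj := OrzechProperty.injective_of_surjective_endomorphism u hsurj
  let e := LinearEquiv.ofBijective u ⟨hinj, hsurj⟩
  have hcomm : ∀ h x, u (ρ h x) = ρ h (u x) := by
    intro h x
    rw [hu, hu, map_sum]
    refine Fintype.sum_equiv (Equiv.mulLeft h⁻¹) _ _ fun g => ?_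
    simp only [Equiv.coe_mulLeft, mul_inv_rev, inv_inv, map_mul, Module.End.mul_apply,
      Representation.self_inv_apply]
  have hcomm' : ∀ h x, e.symm (ρ h x) = ρ h (e.symm x) := by
    intro h x
    rw [LinearEquiv.symm_apply_eq]
    change _ = u _
    rw [hcomm]
    exact congrArg (ρ h) (e.apply_symm_apply x).symm
  refine ⟨f ∘ₗ e.symm.toLinearMap, fun x => ?_⟩
  have := hu (e.symm x)
  refine Eq.trans (Finset.sum_congr rfl fun g _ => ?_) (this.symm.trans (e.apply_symm_apply x))
  simp only [LinearMap.comp_apply, LinearEquiv.coe_coe, hcomm']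

end padic

section final

variable {p : ℕ} [Fact p.Prime] {G : Type} [Group G] 
  {X : Type} [AddCommGroup X] [Module ℤ_[p] X] [Module.Free ℤ_[p] X]
  (ρ : Representation ℤ_[p] G X)

theorem van1_of {W : Type} [AddCommGroup W] [Module ℤ_[p] W] (τ : Representation ℤ_[p] G W)
    (h : Subsingleton (groupCohomology (Rep.of τ) 1)) : Van1 τ := by
  intro c hc
  have hm : c ∈ groupCohomology.cocycles₁ (Rep.of τ) :=
    (groupCohomology.mem_cocycles₁_iff (A := Rep.of τ) c).2 hc
  have := (groupCohomology.H1π_eq_zero_iff (A := Rep.of τ) ⟨c, hm⟩).1 (h.elim _ _)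
  obtain ⟨w, hw⟩ := this
  exact ⟨w, fun g => congrFun hw g⟩

theorem van2_of {W : Type} [AddCommGroup W] [Module ℤ_[p] W] (τ : Representation ℤ_[p] G W)
    (h : Subsingleton (groupCohomology (Rep.of τ) 2)) : Van2 τ := by
  intro c hc
  have hm : (fun x : G × G => c x.1 x.2) ∈ groupCohomology.cocycles₂ (Rep.of τ) :=
    (groupCohomology.mem_cocycles₂_iff (A := Rep.of τ) _).2 hc
  have := (groupCohomology.H2π_eq_zero_iff (A := Rep.of τ) ⟨_, hm⟩).1 (h.elim _ _)
  obtain ⟨w, hw⟩ := this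
  exact ⟨w, fun g h => congrFun hw (g, h)⟩

theorem norm_G [Fintype G] (P : Sylow p G) [Fintype P] (f : X →ₗ[ℤ_[p]] X)
    (hf : ∀ x, ∑ g : P, ρ g (f (ρ (g : G)⁻¹ x)) = x) :
    ∃ f : X →ₗ[ℤ_[p]] X, ∀ x, ∑ g, ρ g⁻¹ (f (ρ g x)) = x := by
  have hidx : IsUnit ((P : Subgroup G).index : ℤ_[p]) := by
    rw [PadicInt.isUnit_iff, PadicInt.norm_natCast_eq_one_iff]
    exact ((Fact.out : p.Prime).coprime_iff_not_dvd.2 P.not_dvd_index)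
  have key : ∀ x, ∑ g, ρ g⁻¹ (f (ρ g x)) = ((P : Subgroup G).index : ℤ_[p]) • x := by
    intro x
    have hP : (Nat.card P : ℤ_[p]) ≠ 0 := Nat.cast_ne_zero.2 Nat.card_pos.ne'
    have hinj : Function.Injective (fun y : X => (Nat.card P : ℤ_[p]) • y) :=
      smul_right_injective X hP
    apply hinj
    change (Nat.card P : ℤ_[p]) • _ = (Nat.card P : ℤ_[p]) • _
    rw [smul_smul, ← Nat.cast_mul, Subgroup.card_mul_index, Nat.cast_smul_eq_nsmul,
      Nat.cast_smul_eq_nsmul]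
    have e1 : ∑ g : G, ∑ h : P, ρ g⁻¹ (ρ h (f (ρ (h : G)⁻¹ (ρ g x)))) = Nat.card G • x := by
      have : ∀ g : G, ∑ h : P, ρ g⁻¹ (ρ h (f (ρ (h : G)⁻¹ (ρ g x)))) = x := by
        intro g
        rw [← map_sum, hf]
        simp
      simp [this, Nat.card_eq_fintype_card]
    rw [← e1, Finset.sum_comm]
    have : ∀ h : P, ∑ g : G, ρ g⁻¹ (ρ h (f (ρ (h : G)⁻¹ (ρ g x)))) = ∑ g, ρ g⁻¹ (f (ρ g x)) := by
      intro h
      refine Fintype.sum_equiv (Equiv.mulLeft (h : G)⁻¹) _ _ fun g => ?_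
      simp [map_mul]
    simp [this, Nat.card_eq_fintype_card]
  obtain ⟨c, hc⟩ := hidx
  refine ⟨(↑c⁻¹ : ℤ_[p]) • f, fun x => ?_⟩
  simp only [LinearMap.smul_apply, map_smul, ← Finset.smul_sum, key, ← hc, smul_smul]
  simp

theorem proj_of_norm [Fintype G] (f : X →ₗ[ℤ_[p]] X)
    (hf : ∀ x, ∑ g, ρ g⁻¹ (f (ρ g x)) = x) :
    Module.Projective (MonoidAlgebra ℤ_[p] G) ρ.asModule := by
  refine Module.Projective.of_lifting_property'' fun q hq => ?_
  have : Module.Projective ℤ_[p] ρ.asModule := .of_equiv ρ.asModuleEquiv.symm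
  obtain ⟨s, hs⟩ := Module.projective_lifting_property (q.restrictScalars ℤ_[p])
    (LinearMap.id : ρ.asModule →ₗ[ℤ_[p]] ρ.asModule) hq
  let f' : ρ.asModule →ₗ[ℤ_[p]] ρ.asModule :=
    ρ.asModuleEquiv.symm.toLinearMap ∘ₗ f ∘ₗ ρ.asModuleEquiv.toLinearMap
  refine ⟨(s ∘ₗ f').sumOfConjugatesEquivariant G, LinearMap.ext fun x => ?_⟩
  rw [LinearMap.comp_apply, LinearMap.sumOfConjugatesEquivariant_apply, map_sum]
  refine Eq.trans (Finset.sum_congr rfl fun g _ => ?_) (hf (ρ.asModuleEquiv x))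
  rw [LinearMap.conjugate_apply, map_smul, LinearMap.comp_apply]
  have := LinearMap.congr_fun hs (f' (MonoidAlgebra.single g (1 : ℤ_[p]) • x))
  change q (s _) = _ at this
  rw [this]
  simp only [Representation.single_smul, one_smul]
  rfl

end final
end PfAux

theorem statement0 (p : ℕ) [Fact p.Prime] (G : Type) [Group G] [Finite G]
    (X : Type) [AddCommGroup X] [Module ℤ_[p] X]
    [Module.Free ℤ_[p] X] [Module.Finite ℤ_[p] X]
    (ρ : Representation ℤ_[p] G X)
    (hvanish : ∀ H : Subgroup G, ∀ i : ℕ, (i = 1 ∨ i = 2) →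
      Subsingleton (groupCohomology
        (Rep.of (Representation.linHom (ρ.comp H.subtype)
          (Representation.trivial ℤ_[p] (G := H) (V := QpZp p)))) i)) :
    Module.Projective (MonoidAlgebra ℤ_[p] G) ρ.asModule := by
  classical
  have := Fintype.ofFinite G
  obtain ⟨P⟩ : Nonempty (Sylow p G) := inferInstance
  have : Fintype (P : Subgroup G) := Fintype.ofFinite _
  obtain ⟨f, hf⟩ := PfAux.pgroup_case (ρ.comp (P : Subgroup G).subtype) P.isPGroup'
    (PfAux.van1_of _ (hvanish P 1 (Or.inl rfl))) (PfAux.van2_of _ (hvanish P 2 (Or.inr rfl)))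
  obtain ⟨f', hf'⟩ := PfAux.norm_G ρ P f hf
  exact PfAux.proj_of_norm ρ f' hf'
end

section
/- Let Λ = Zp[[T]] be the Iwasawa algebra and M a finitely generated torsion Λ-module. Then θ(M) ≤ 1 if and only if M/M[p] is finitely generated as a Zp-module, and in that case λ(M) = rank_Zp(M/M[p]). -/
open scoped Classical

local notation "Λp" p => PowerSeries ℤ_[p]

namespace Iwasawa11

variable {p : ℕ} [Fact p.Prime]

lemma rank_zero_of_finite {A : Type} [AddCommGroup A] [Module ℤ_[p] A] [Finite A] :
    Module.rank ℤ_[p] A = 0 := by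
  rw [Module.rank_eq_zero_iff_isTorsion]
  intro x
  refine ⟨⟨(Nat.card A : ℤ_[p]), ?_⟩, ?_⟩
  · rw [mem_nonZeroDivisors_iff_ne_zero]
    exact_mod_cast Nat.card_pos.ne'
  · change (Nat.card A : ℤ_[p]) • x = 0
    rw [Nat.cast_smul_eq_nsmul]
    exact card_nsmul_eq_zero'

lemma finite_iff_of_pseudo {A B : Type} [AddCommGroup A] [Module ℤ_[p] A]
    [AddCommGroup B] [Module ℤ_[p] B] (ψ : A →ₗ[ℤ_[p]] B)
    (hk : Finite (LinearMap.ker ψ)) (hc : Finite (B ⧸ LinearMap.range ψ)) :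
    (Module.Finite ℤ_[p] A ↔ Module.Finite ℤ_[p] B) ∧
      Module.finrank ℤ_[p] A = Module.finrank ℤ_[p] B := by
  refine ⟨⟨fun h => ?_, fun h => ?_⟩, ?_⟩
  · exact Module.Finite.of_submodule_quotient (LinearMap.range ψ)
  · have : Module.Finite ℤ_[p] (A ⧸ LinearMap.ker ψ) :=
      Module.Finite.equiv ψ.quotKerEquivRange.symm
    exact Module.Finite.of_submodule_quotient (LinearMap.ker ψ)
  · have h1 := LinearMap.rank_range_add_rank_ker ψ
    have h2 := Submodule.rank_quotient_add_rank (LinearMap.range ψ)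
    rw [rank_zero_of_finite (A := LinearMap.ker ψ)] at h1
    rw [rank_zero_of_finite (A := B ⧸ LinearMap.range ψ)] at h2
    unfold Module.finrank
    rw [← h1, ← h2, add_zero, zero_add]

open PowerSeries in
lemma not_finite_quot (I : Ideal ℤ_[p]⟦X⟧) (hI : I ≤ Ideal.span {(p : ℤ_[p]⟦X⟧)}) :
    ¬ Module.Finite ℤ_[p] (ℤ_[p]⟦X⟧ ⧸ I) := by
  intro h
  let k := IsLocalRing.ResidueField ℤ_[p]
  let g : ℤ_[p]⟦X⟧ →ₐ[ℤ_[p]] k⟦X⟧ := PowerSeries.mapAlgHom (Algebra.ofId ℤ_[p] k)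
  have hg : Function.Surjective g := by
    intro y
    choose c hc using fun n => IsLocalRing.residue_surjective (R := ℤ_[p]) (coeff n y)
    refine ⟨PowerSeries.mk c, ?_⟩
    ext n
    simp only [g, PowerSeries.mapAlgHom_apply, PowerSeries.coeff_map, PowerSeries.coeff_mk]
    exact hc n
  have hgp : ∀ x ∈ I, g x = 0 := by
    intro x hx
    obtain ⟨y, rfl⟩ := Ideal.mem_span_singleton'.1 (hI hx)
    have : g (p : ℤ_[p]⟦X⟧) = 0 := by
      rw [map_natCast]
      have : (p : k) = 0 := by
        rw [← map_natCast (IsLocalRing.residue ℤ_[p]), IsLocalRing.residue_eq_zero_iff,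
          PadicInt.maximalIdeal_eq_span_p]
        exact Ideal.mem_span_singleton_self _
      rw [← map_natCast (PowerSeries.C (R := k)), this, map_zero]
    rw [map_mul, this, mul_zero]
  have h1 : Module.Finite ℤ_[p] k⟦X⟧ :=
    Module.Finite.of_surjective (Ideal.Quotient.liftₐ I g hgp).toLinearMap
      (Ideal.Quotient.lift_surjective_of_surjective I hgp hg)
  have h2 : Module.Finite k k⟦X⟧ := Module.Finite.of_restrictScalars_finite ℤ_[p] k _
  exact Polynomial.not_finite (R := k) (Module.Finite.of_injective
    (Polynomial.coeToPowerSeries.algHom (R := k) k).toLinearMap (by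
      intro a b hab
      apply Polynomial.coe_injective k
      simpa [Polynomial.coeToPowerSeries.algHom_apply] using hab))

open PowerSeries in
lemma dist_quot (f : Polynomial ℤ_[p]) (b : ℕ) (hf : f.Monic ∧
      ∀ i < f.natDegree, f.coeff i ∈ IsLocalRing.maximalIdeal ℤ_[p]) :
    Module.Finite ℤ_[p] (ℤ_[p]⟦X⟧ ⧸ Ideal.span {(f : ℤ_[p]⟦X⟧) ^ b}) ∧
    Module.Free ℤ_[p] (ℤ_[p]⟦X⟧ ⧸ Ideal.span {(f : ℤ_[p]⟦X⟧) ^ b}) ∧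
    Module.finrank ℤ_[p] (ℤ_[p]⟦X⟧ ⧸ Ideal.span {(f : ℤ_[p]⟦X⟧) ^ b}) = b * f.natDegree := by
  have hd : f.IsDistinguishedAt (IsLocalRing.maximalIdeal ℤ_[p]) :=
    { mem := fun {i} hi => hf.2 i hi, monic := hf.1 }
  have hdb : (f ^ b).IsDistinguishedAt (IsLocalRing.maximalIdeal ℤ_[p]) := by
    induction b with
    | zero => exact { mem := fun {i} hi => by simp at hi, monic := by simp }
    | succ n ih => rw [pow_succ]; exact ih.mul hd
  have hm : (f ^ b).Monic := hdb.monic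
  have e := hdb.algEquivQuotient.toLinearEquiv
  rw [Polynomial.coe_pow] at e
  have := (AdjoinRoot.powerBasis' hm).basis
  have h1 : Module.Finite ℤ_[p] (Polynomial ℤ_[p] ⧸ Ideal.span {f ^ b}) := hm.finite_quotient
  have h2 : Module.Free ℤ_[p] (Polynomial ℤ_[p] ⧸ Ideal.span {f ^ b}) := hm.free_quotient
  refine ⟨Module.Finite.equiv e, Module.Free.of_equiv e, ?_⟩
  rw [← e.finrank_eq, finrank_quotient_span_eq_natDegree' hm, hf.1.natDegree_pow]

open PowerSeries in
theorem main (M Q N P : Type) [AddCommGroup M] [Module ℤ_[p]⟦X⟧ M]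
    [AddCommGroup Q] [Module ℤ_[p]⟦X⟧ Q] [Module ℤ_[p] Q] [IsScalarTower ℤ_[p] ℤ_[p]⟦X⟧ Q]
    [AddCommGroup N] [Module ℤ_[p]⟦X⟧ N] [Module ℤ_[p] N] [IsScalarTower ℤ_[p] ℤ_[p]⟦X⟧ N]
    [AddCommGroup P] [Module ℤ_[p]⟦X⟧ P] [Module ℤ_[p] P] [IsScalarTower ℤ_[p] ℤ_[p]⟦X⟧ P]
    (φ : M →ₗ[ℤ_[p]⟦X⟧] N)
    (hker : Finite (LinearMap.ker φ)) (hcoker : Finite (N ⧸ LinearMap.range φ))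
    (r : M →ₗ[ℤ_[p]⟦X⟧] Q) (hr : Function.Surjective r)
    (hrk : ∀ m, r m = 0 ↔ (p : ℤ_[p]⟦X⟧) • m = 0)
    (q : N →ₗ[ℤ_[p]⟦X⟧] P) (hq : Function.Surjective q)
    (hqk : ∀ m, q m = 0 ↔ (p : ℤ_[p]⟦X⟧) • m = 0) :
    (Module.Finite ℤ_[p] Q ↔ Module.Finite ℤ_[p] P) ∧
      Module.finrank ℤ_[p] Q = Module.finrank ℤ_[p] P := by
  have hle : LinearMap.ker r ≤ LinearMap.ker (q ∘ₗ φ) := by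
    intro m hm
    rw [LinearMap.mem_ker, hrk] at hm
    rw [LinearMap.mem_ker, LinearMap.comp_apply, hqk, ← map_smul, hm, map_zero]
  let ψ : Q →ₗ[ℤ_[p]⟦X⟧] P :=
    (Submodule.liftQ _ (q ∘ₗ φ) hle) ∘ₗ (r.quotKerEquivOfSurjective hr).symm.toLinearMap
  have hψ : ∀ m, ψ (r m) = q (φ m) := by
    intro m
    have : (r.quotKerEquivOfSurjective hr).symm (r m) = Submodule.Quotient.mk m := by
      rw [LinearEquiv.symm_apply_eq]; rfl
    simp only [ψ, LinearMap.comp_apply, LinearEquiv.coe_coe, this]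
    rfl
  refine finite_iff_of_pseudo (ψ.restrictScalars ℤ_[p]) ?_ ?_
  · choose g hg using id hr
    refine Finite.of_injective (β := LinearMap.ker φ)
      (fun x => ⟨(p : ℤ_[p]⟦X⟧) • g x.1, ?_⟩) ?_
    · have hx : ψ x.1 = 0 := x.2
      rw [← hg x.1, hψ, hqk] at hx
      rwa [LinearMap.mem_ker, map_smul]
    · intro x y hxy
      have h : (p : ℤ_[p]⟦X⟧) • g x.1 = (p : ℤ_[p]⟦X⟧) • g y.1 := congrArg Subtype.val hxy
      rw [← sub_eq_zero, ← smul_sub, ← hrk, map_sub, hg, hg, sub_eq_zero] at h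
      exact Subtype.ext h
  · have hle2 : LinearMap.range φ ≤ LinearMap.ker ((LinearMap.range ψ).mkQ ∘ₗ q) := by
      rintro _ ⟨m, rfl⟩
      rw [LinearMap.mem_ker, LinearMap.comp_apply, ← hψ, Submodule.mkQ_apply,
        Submodule.Quotient.mk_eq_zero]
      exact ⟨_, rfl⟩
    have hf : Finite (P ⧸ LinearMap.range ψ) := by
      refine Finite.of_surjective (Submodule.liftQ _ _ hle2) ?_
      intro y
      obtain ⟨z, rfl⟩ := Submodule.mkQ_surjective _ y
      obtain ⟨n, rfl⟩ := hq z
      exact ⟨Submodule.Quotient.mk n, rfl⟩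
    refine Finite.of_surjective (α := P ⧸ LinearMap.range ψ)
      (Quotient.map' (s₁ := (LinearMap.range ψ).quotientRel) id ?_) ?_
    · intro a b hab
      rw [Submodule.quotientRel_def] at hab ⊢
      exact hab
    · intro y
      induction y using Quotient.inductionOn' with
      | h a => exact ⟨Quotient.mk'' a, rfl⟩

open PowerSeries in
lemma finite_quot_ker {P : Type} [AddCommGroup P] [Module ℤ_[p]⟦X⟧ P] [Module ℤ_[p] P]
    [IsScalarTower ℤ_[p] ℤ_[p]⟦X⟧ P] [Module.Finite ℤ_[p] P] (g : ℤ_[p]⟦X⟧ →ₗ[ℤ_[p]⟦X⟧] P) :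
    Module.Finite ℤ_[p] (ℤ_[p]⟦X⟧ ⧸ (LinearMap.ker g : Ideal ℤ_[p]⟦X⟧)) := by
  have h : Function.Injective ((LinearMap.ker g).liftQ g le_rfl) :=
    LinearMap.ker_eq_bot.1 (Submodule.ker_liftQ_eq_bot _ _ _ le_rfl)
  exact Module.Finite.of_injective (((LinearMap.ker g).liftQ g le_rfl).restrictScalars ℤ_[p]) h

open PowerSeries in
lemma torsionfree_quot (I : Ideal ℤ_[p]⟦X⟧) (hf : Module.Free ℤ_[p] (ℤ_[p]⟦X⟧ ⧸ I))
    (a : ℤ_[p]⟦X⟧ ⧸ I) (ha : (p : ℤ_[p]⟦X⟧) • a = 0) : a = 0 := by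
  have h3 : (p : ℤ_[p]) • a = 0 := by
    obtain ⟨c, rfl⟩ := Ideal.Quotient.mk_surjective a
    change Ideal.Quotient.mk I ((p : ℤ_[p]⟦X⟧) * c) = 0 at ha
    change Ideal.Quotient.mk I ((p : ℤ_[p]) • c) = 0
    rw [← ha, Algebra.smul_def, map_natCast]
  exact (smul_eq_zero.1 h3).resolve_left (by exact_mod_cast (Fact.out : p.Prime).ne_zero)

lemma finrank_pi' {t : ℕ} (W : Fin t → Type) [∀ j, AddCommGroup (W j)]
    [∀ j, Module ℤ_[p] (W j)] (h1 : ∀ j, Module.Finite ℤ_[p] (W j))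
    (h2 : ∀ j, Module.Free ℤ_[p] (W j)) :
    Module.finrank ℤ_[p] (∀ j, W j) = ∑ j, Module.finrank ℤ_[p] (W j) :=
  Module.finrank_pi_fintype _

open PowerSeries in
theorem target (s t : ℕ) (α : Fin s → ℕ) (β : Fin t → ℕ) 
    (f : Fin t → Polynomial ℤ_[p])
    (hfdist : ∀ j, (f j).Monic ∧
      ∀ i < (f j).natDegree, (f j).coeff i ∈ IsLocalRing.maximalIdeal ℤ_[p])
    (P : Type) [AddCommGroup P] [Module ℤ_[p]⟦X⟧ P] [Module ℤ_[p] P]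
    [IsScalarTower ℤ_[p] ℤ_[p]⟦X⟧ P]
    (q : (((i : Fin s) → ℤ_[p]⟦X⟧ ⧸ Ideal.span {(p : ℤ_[p]⟦X⟧) ^ α i}) ×
        ((j : Fin t) → ℤ_[p]⟦X⟧ ⧸ Ideal.span {((f j : ℤ_[p]⟦X⟧)) ^ β j})) →ₗ[ℤ_[p]⟦X⟧] P)
    (hq : Function.Surjective q)
    (hqk : ∀ m, q m = 0 ↔ (p : ℤ_[p]⟦X⟧) • m = 0) :
    ((∀ i, α i ≤ 1) ↔ Module.Finite ℤ_[p] P) ∧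
    ((∀ i, α i ≤ 1) → ∑ j, β j * (f j).natDegree = Module.finrank ℤ_[p] P) := by
  have hfin := fun j => (dist_quot (f j) (β j) (hfdist j)).1
  have hfree := fun j => (dist_quot (f j) (β j) (hfdist j)).2.1
  have hrank := fun j => (dist_quot (f j) (β j) (hfdist j)).2.2
  have key : (∀ i, α i ≤ 1) → Nonempty
      (((j : Fin t) → ℤ_[p]⟦X⟧ ⧸ Ideal.span {((f j : ℤ_[p]⟦X⟧)) ^ β j}) ≃ₗ[ℤ_[p]] P) := by
    intro h
    refine ⟨LinearEquiv.ofBijective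
      ((q ∘ₗ LinearMap.inr ℤ_[p]⟦X⟧ _ _).restrictScalars ℤ_[p]) ⟨?_, ?_⟩⟩
    · rw [injective_iff_map_eq_zero]
      intro a ha
      have ha : q (0, a) = 0 := ha
      rw [hqk] at ha
      have h2 : (p : ℤ_[p]⟦X⟧) • a = 0 := congrArg Prod.snd ha
      funext j
      have h3 : (p : ℤ_[p]⟦X⟧) • a j = 0 := congrFun h2 j
      exact torsionfree_quot _ (hfree j) (a j) h3
    · intro y
      obtain ⟨⟨a, b⟩, rfl⟩ := hq y
      refine ⟨b, ?_⟩
      change q (0, b) = q (a, b)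
      have : q (a, 0) = 0 := by
        rw [hqk]
        refine Prod.ext ?_ (smul_zero _)
        funext i
        change (p : ℤ_[p]⟦X⟧) • a i = 0
        obtain ⟨c, hc⟩ := Ideal.Quotient.mk_surjective (a i)
        rw [← hc]
        change Ideal.Quotient.mk _ ((p : ℤ_[p]⟦X⟧) * c) = 0
        rw [Ideal.Quotient.eq_zero_iff_mem, Ideal.mem_span_singleton]
        exact dvd_mul_of_dvd_left ((pow_dvd_pow _ (h i)).trans (by rw [pow_one])) _
      rw [show ((a, b) : _ × _) = (a, 0) + (0, b) by simp, map_add, this, zero_add]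
  refine ⟨⟨fun h => ?_, fun h i => ?_⟩, fun h => ?_⟩
  · obtain ⟨e⟩ := key h
    exact Module.Finite.equiv e
  · by_contra hi
    push Not at hi
    let g : ℤ_[p]⟦X⟧ →ₗ[ℤ_[p]⟦X⟧] P := q ∘ₗ LinearMap.inl ℤ_[p]⟦X⟧ _ _ ∘ₗ
      LinearMap.single ℤ_[p]⟦X⟧ (fun i : Fin s => ℤ_[p]⟦X⟧ ⧸ Ideal.span {(p : ℤ_[p]⟦X⟧) ^ α i}) i ∘ₗ
      (Ideal.span {(p : ℤ_[p]⟦X⟧) ^ α i}).mkQ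
    refine not_finite_quot (LinearMap.ker g) ?_ ?_
    · intro x hx
      have hx : q (Pi.single i (Ideal.Quotient.mk _ x), 0) = 0 := hx
      rw [hqk] at hx
      have h2 := congrFun (congrArg Prod.fst hx) i
      simp only [Prod.smul_fst, Pi.smul_apply, Pi.single_eq_same, Prod.fst_zero,
        Pi.zero_apply] at h2
      change Ideal.Quotient.mk _ ((p : ℤ_[p]⟦X⟧) * x) = 0 at h2
      rw [Ideal.Quotient.eq_zero_iff_mem, Ideal.mem_span_singleton] at h2
      have h3 := (pow_dvd_pow (p : ℤ_[p]⟦X⟧) (show 2 ≤ α i from hi)).trans h2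
      rw [pow_two] at h3
      have hp0 : (p : ℤ_[p]⟦X⟧) ≠ 0 := by
        intro h0
        have h4 := congrArg (PowerSeries.constantCoeff (R := ℤ_[p])) h0
        rw [map_natCast, map_zero] at h4
        exact (Fact.out : p.Prime).ne_zero (by exact_mod_cast h4)
      exact Ideal.mem_span_singleton.2 ((mul_dvd_mul_iff_left hp0).1 h3)
    · exact finite_quot_ker g
  · obtain ⟨e⟩ := key h
    rw [← e.finrank_eq, finrank_pi' _ hfin hfree]
    exact Finset.sum_congr rfl fun j _ => (hrank j).symm

end Iwasawa11

/-- let `M` be a finitely generated torsion module over the Iwasawa algebra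
`Λ = ℤ_p[[T]]`, with structural decomposition (up to pseudo-isomorphism)
`(⊕ Λ/p^{α_i}) ⊕ (⊕ Λ/f_j^{β_j})`, the `f_j` irreducible distinguished polynomials.
Then `θ(M) = max α_i ≤ 1` iff `M/M[p]` is finitely generated over `ℤ_p`, in which case
`λ(M) = Σ β_j·deg f_j = rank_{ℤ_p}(M/M[p])`. -/
theorem statement11 (p : ℕ) [Fact p.Prime]
    (M : Type) [AddCommGroup M] [Module (PowerSeries ℤ_[p]) M]
    [Module.Finite (PowerSeries ℤ_[p]) M]
    (htor : Module.IsTorsion (PowerSeries ℤ_[p]) M)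
    (s t : ℕ) (α : Fin s → ℕ) (hα : ∀ i, 0 < α i) (β : Fin t → ℕ) (hβ : ∀ j, 0 < β j)
    (f : Fin t → Polynomial ℤ_[p])
    (hfirr : ∀ j, Irreducible (f j))
    (hfdist : ∀ j, (f j).Monic ∧
      ∀ i < (f j).natDegree, (f j).coeff i ∈ IsLocalRing.maximalIdeal ℤ_[p])
    (φ : M →ₗ[PowerSeries ℤ_[p]]
      (((i : Fin s) → (PowerSeries ℤ_[p]) ⧸
          Ideal.span {(p : PowerSeries ℤ_[p]) ^ α i}) ×
        ((j : Fin t) → (PowerSeries ℤ_[p]) ⧸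
          Ideal.span {((f j : PowerSeries ℤ_[p])) ^ β j})))
    (hker : Finite (LinearMap.ker φ)) (hcoker : Finite ((_ ⧸ LinearMap.range φ))) :
    ((∀ i, α i ≤ 1) ↔ Module.Finite ℤ_[p]
        (RestrictScalars ℤ_[p] (PowerSeries ℤ_[p])
          (M ⧸ Submodule.torsionBy (PowerSeries ℤ_[p]) M (p : PowerSeries ℤ_[p])))) ∧
    ((∀ i, α i ≤ 1) →
      ∑ j, β j * (f j).natDegree =
        Module.finrank ℤ_[p] (RestrictScalars ℤ_[p] (PowerSeries ℤ_[p])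
          (M ⧸ Submodule.torsionBy (PowerSeries ℤ_[p]) M (p : PowerSeries ℤ_[p])))) := by
  let P := LinearMap.range (LinearMap.lsmul (PowerSeries ℤ_[p]) (((i : Fin s) → (PowerSeries ℤ_[p]) ⧸
          Ideal.span {(p : PowerSeries ℤ_[p]) ^ α i}) ×
        ((j : Fin t) → (PowerSeries ℤ_[p]) ⧸
          Ideal.span {((f j : PowerSeries ℤ_[p])) ^ β j})) (p : PowerSeries ℤ_[p]))
  let q := LinearMap.rangeRestrict (LinearMap.lsmul (PowerSeries ℤ_[p]) (((i : Fin s) → (PowerSeries ℤ_[p]) ⧸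
          Ideal.span {(p : PowerSeries ℤ_[p]) ^ α i}) ×
        ((j : Fin t) → (PowerSeries ℤ_[p]) ⧸
          Ideal.span {((f j : PowerSeries ℤ_[p])) ^ β j})) (p : PowerSeries ℤ_[p]))
  have hq : Function.Surjective q := LinearMap.surjective_rangeRestrict _
  have hqk : ∀ m, q m = 0 ↔ (p : PowerSeries ℤ_[p]) • m = 0 := by
    intro m
    rw [← Subtype.coe_inj]
    rfl
  let T := Submodule.torsionBy (PowerSeries ℤ_[p]) M (p : PowerSeries ℤ_[p])
  let _ : Module ℤ_[p] (M ⧸ T) := Module.compHom _ (algebraMap ℤ_[p] (PowerSeries ℤ_[p]))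
  have : IsScalarTower ℤ_[p] (PowerSeries ℤ_[p]) (M ⧸ T) :=
    IsScalarTower.of_algebraMap_smul fun _ _ => rfl
  let r : M →ₗ[PowerSeries ℤ_[p]] (M ⧸ T) := T.mkQ
  have hr : Function.Surjective r := T.mkQ_surjective
  have hrk : ∀ m, r m = 0 ↔ (p : PowerSeries ℤ_[p]) • m = 0 := by
    intro m
    change T.mkQ m = 0 ↔ _
    rw [Submodule.mkQ_apply, Submodule.Quotient.mk_eq_zero]
    exact Submodule.mem_torsionBy_iff _ _
  have h1 := Iwasawa11.main M _ _ P φ hker hcoker r hr hrk q hq hqk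
  have h2 := Iwasawa11.target s t α β f hfdist P q hq hqk
  exact ⟨h2.1.trans h1.1.symm, fun h => (h2.2 h).trans h1.2.symm⟩
end
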